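/- Let U take values in a finite alphabet of size L and Q in a finite alphabet. Then P_e(U|Q) ≤ ((L-1)/2) Z_L(U|Q), where P_e(U|Q) = Σ_q P(q)(1 - max_u P(u|q)) and Z_L(U|Q) = (1/(L-1)) Σ_q P(q) Σ_{u≠u'} √(P(u|q)P(u'|q)). -/

import Mathlib

open Finset

/-- Each pair formed by a maximizer `m` of `f` and another point `u` has geometric mean at least
`f u`, and occurs in both orders. -/
theorem two_mul_sum_erase_le_sum_sum_sqrt {U : Type*} [Fintype U] [DecidableEq U] {f : U → ℝ}
    (hf : ∀ u, 0 ≤ f u) {m : U} (hm : ∀ u, f u ≤ f m) :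
    2 * ∑ u ∈ univ.erase m, f u ≤ ∑ u, ∑ u' ∈ univ.erase u, √(f u * f u') := by
  have le_sqrt_max (u : U) : f u ≤ √(f m * f u) :=
    Real.le_sqrt_of_sq_le (by nlinarith [mul_le_mul_of_nonneg_right (hm u) (hf u)])
  rw [← add_sum_erase univ _ (mem_univ m), two_mul]
  refine add_le_add (sum_le_sum fun u _ => le_sqrt_max u) (sum_le_sum fun u hu => ?_)
  calc f u ≤ √(f u * f m) := by rw [mul_comm]; exact le_sqrt_max u
    _ ≤ ∑ u' ∈ univ.erase u, √(f u * f u') :=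
      single_le_sum (f := fun u' => √(f u * f u')) (fun _ _ => Real.sqrt_nonneg _)
        (mem_erase.2 ⟨(ne_of_mem_erase hu).symm, mem_univ m⟩)

/-- For a probability vector `f`, the error of guessing its mode is at most half the sum of
`√(f u * f u')` over ordered pairs of distinct points. -/
theorem one_sub_sup_le_half_sum_sum_sqrt {U : Type*} [Fintype U] [DecidableEq U] [Nonempty U]
    {f : U → ℝ} (hf : ∀ u, 0 ≤ f u) (hsum : ∑ u, f u = 1) :
    1 - univ.sup' univ_nonempty f ≤ (∑ u, ∑ u' ∈ univ.erase u, √(f u * f u')) / 2 := by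
  obtain ⟨m, -, hm⟩ := exists_mem_eq_sup' univ_nonempty f
  have hle := two_mul_sum_erase_le_sum_sum_sqrt hf (m := m)
    fun u => hm ▸ le_sup' f (mem_univ u)
  have hsplit := add_sum_erase univ f (mem_univ m)
  rw [hm]
  linarith

theorem nonbinary_pe_le_bhattacharyya
    {U Q : Type*} [Fintype U] [DecidableEq U] [Fintype Q] [Nonempty U] (L : ℕ) (hL : 2 ≤ L)
    (hcard : Fintype.card U = L)
    (p : Q → ℝ) (W : Q → U → ℝ)
    (hp : ∀ q, 0 ≤ p q) (hpsum : ∑ q, p q = 1)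
    (hW : ∀ q u, 0 ≤ W q u) (hWsum : ∀ q, ∑ u, W q u = 1) :
    (∑ q, p q * (1 - Finset.univ.sup' Finset.univ_nonempty (fun u => W q u))) ≤
      (((L : ℝ) - 1) / 2) *
        ((1 / ((L : ℝ) - 1)) *
          ∑ q, p q * ∑ u, ∑ u' ∈ Finset.univ.erase u, Real.sqrt (W q u * W q u')) := by
  have hL' : (L : ℝ) - 1 ≠ 0 := by
    have : (2 : ℝ) ≤ L := by exact_mod_cast hL
    linarith
  rw [← mul_assoc, show ((L : ℝ) - 1) / 2 * (1 / ((L : ℝ) - 1)) = 1 / 2 by field_simp, mul_sum]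
  refine sum_le_sum fun q _ => ?_
  calc _ ≤ p q * ((∑ u, ∑ u' ∈ univ.erase u, √(W q u * W q u')) / 2) :=
        mul_le_mul_of_nonneg_left (one_sub_sup_le_half_sum_sum_sqrt (hW q) (hWsum q)) (hp q)
    _ = _ := by ring
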